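/- (Poincaré's limit theorem, strengthened form) Fix an integer l ≥ 1. For each k ≥ l, let σ_k denote the uniform (normalized) probability measure on the sphere S_{√k}^{k−1} = { x ∈ ℝ^k : ‖x‖ = √k }, and let π_{k,l} : ℝ^k → ℝ^l denote the orthogonal projection onto the first l coordinates. Then for every Borel set A ⊆ ℝ^l, lim_{k→∞} σ_k( π_{k,l}^{−1}(A) ∩ S_{√k}^{k−1} ) = (2π)^{−l/2} ∫_A exp(−‖y‖²/2) dy. -/

import Mathlib

open MeasureTheory ProbabilityTheory Matrix Filter
open scoped ProbabilityTheory ENNReal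

/-- Orthogonal projection of ℝ^(l+m) onto the first l coordinates. -/
noncomputable def projEuclid (l m : ℕ) (x : EuclideanSpace ℝ (Fin (l + m))) :
    EuclideanSpace ℝ (Fin l) :=
  (WithLp.equiv 2 (Fin l → ℝ)).symm fun i =>
    WithLp.equiv 2 (Fin (l + m) → ℝ) x (Fin.castLE (Nat.le_add_right l m) i)


/-- Two rotation-invariant probability measures on the same sphere coincide. -/
lemma invariant_unique {k : ℕ} {r : ℝ} (hr : 0 < r)
    (μ ν : Measure (EuclideanSpace ℝ (Fin k))) [IsProbabilityMeasure μ] [IsProbabilityMeasure ν]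
    (hμ : ∀ᵐ x ∂μ, ‖x‖ = r) (hν : ∀ᵐ x ∂ν, ‖x‖ = r)
    (iμ : ∀ O : EuclideanSpace ℝ (Fin k) ≃ₗᵢ[ℝ] EuclideanSpace ℝ (Fin k), μ.map (⇑O) = μ)
    (iν : ∀ O : EuclideanSpace ℝ (Fin k) ≃ₗᵢ[ℝ] EuclideanSpace ℝ (Fin k), ν.map (⇑O) = ν) :
    μ = ν := by
  have key : ∀ (ρ : Measure (EuclideanSpace ℝ (Fin k))) [IsProbabilityMeasure ρ],
      (∀ O : EuclideanSpace ℝ (Fin k) ≃ₗᵢ[ℝ] EuclideanSpace ℝ (Fin k), ρ.map (⇑O) = ρ) →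
      ∀ s t : EuclideanSpace ℝ (Fin k), ‖s‖ = ‖t‖ → charFun ρ s = charFun ρ t := by
    intro ρ _ iρ s t hst
    set O := Submodule.reflection (ℝ ∙ (s - t))ᗮ with hO
    have hOs : O s = t := Submodule.reflection_sub hst
    rw [← hOs]
    conv_rhs => rw [← iρ O]
    rw [charFun_apply, charFun_apply, integral_map O.continuous.measurable.aemeasurable
      (by apply Continuous.aestronglyMeasurable; fun_prop)]
    simp [LinearIsometryEquiv.inner_map_map]
  have key2 : ∀ (ρ τ : Measure (EuclideanSpace ℝ (Fin k))) [IsProbabilityMeasure ρ]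
      [IsProbabilityMeasure τ],
      (∀ O : EuclideanSpace ℝ (Fin k) ≃ₗᵢ[ℝ] EuclideanSpace ℝ (Fin k), ρ.map (⇑O) = ρ) →
      (∀ᵐ x ∂τ, ‖x‖ = r) →
      ∀ s : EuclideanSpace ℝ (Fin k),
        ∫ y, ∫ x, Complex.exp ((‖s‖ / r : ℝ) * (inner ℝ x y : ℝ) * Complex.I) ∂ρ ∂τ
          = charFun ρ s := by
    intro ρ τ _ _ iρ hτ s
    have : ∀ᵐ y ∂τ, ∫ x, Complex.exp ((‖s‖ / r : ℝ) * (inner ℝ x y : ℝ) * Complex.I) ∂ρ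
        = charFun ρ s := by
      filter_upwards [hτ] with y hy
      rw [key ρ iρ s ((‖s‖ / r) • y)]
      · rw [charFun_apply]
        simp [real_inner_smul_right]
      · rw [norm_smul, hy, Real.norm_of_nonneg (by positivity)]
        field_simp
    rw [integral_congr_ae this]
    simp
  apply Measure.ext_of_charFun
  ext s
  rw [← key2 μ ν iμ hν s, ← key2 ν μ iν hμ s, integral_integral_swap]
  · simp_rw [real_inner_comm]
  · refine Integrable.of_bound (C := 1) ?_ ?_
    · apply Continuous.aestronglyMeasurable
      unfold Function.uncurry
      fun_prop
    · refine Eventually.of_forall fun p => ?_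
      simp only [Function.uncurry]
      rw [← Complex.ofReal_mul, Complex.norm_exp_ofReal_mul_I]

lemma stdGaussian_density (l : ℕ) :
    stdGaussian (EuclideanSpace ℝ (Fin l)) =
      (volume : Measure (EuclideanSpace ℝ (Fin l))).withDensity
        (fun y => ENNReal.ofReal ((2 * Real.pi) ^ (-(l : ℝ) / 2) * Real.exp (-‖y‖ ^ 2 / 2))) := by
  set f : EuclideanSpace ℝ (Fin l) → ℝ :=
    fun y => (2 * Real.pi) ^ (-(l : ℝ) / 2) * Real.exp (-‖y‖ ^ 2 / 2) with hf
  have hf0 : ∀ y, 0 ≤ f y := fun y => by positivity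
  have hfm : Measurable f := by fun_prop
  have hint : Integrable f := by
    have := (GaussianFourier.integrable_cexp_neg_mul_sq_norm_add (V := EuclideanSpace ℝ (Fin l))
      (b := 1/2) (by norm_num) 0 0).norm
    refine (this.const_mul ((2 * Real.pi) ^ (-(l : ℝ) / 2))).congr ?_
    refine Eventually.of_forall fun y => ?_
    simp only [hf]
    congr 1
    rw [Complex.norm_exp]
    congr 1
    simp [← Complex.ofReal_pow]
    ring
  have : IsFiniteMeasure ((volume : Measure (EuclideanSpace ℝ (Fin l))).withDensity
      (fun y => ENNReal.ofReal (f y))) := isFiniteMeasure_withDensity_ofReal hint.2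
  apply Measure.ext_of_charFun
  ext t
  rw [charFun_stdGaussian, charFun_apply]
  rw [integral_withDensity_eq_integral_toReal_smul (by fun_prop) (by simp)]
  have h := GaussianFourier.integral_cexp_neg_mul_sq_norm_add (V := EuclideanSpace ℝ (Fin l))
      (b := 1/2) (by norm_num) Complex.I t
  have h2 : ∀ y : EuclideanSpace ℝ (Fin l), (ENNReal.ofReal (f y)).toReal •
      Complex.exp ((inner ℝ y t : ℝ) * Complex.I) =
      (((2 * Real.pi) ^ (-(l : ℝ) / 2) : ℝ) : ℂ) *
        Complex.exp (-(1/2) * ‖y‖ ^ 2 + Complex.I * (inner ℝ t y : ℝ)) := by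
    intro y
    rw [ENNReal.toReal_ofReal (hf0 y), Complex.exp_add, Complex.real_smul, real_inner_comm]
    simp only [hf]
    push_cast
    rw [mul_assoc]
    congr 3
    · ring_nf
    · ring_nf
  rw [integral_congr_ae (Eventually.of_forall h2)]
  rw [integral_const_mul, h, ← mul_assoc]
  have h3 : (((2 * Real.pi) ^ (-(l : ℝ) / 2) : ℝ) : ℂ) *
      (Real.pi / (1/2)) ^ ((Module.finrank ℝ (EuclideanSpace ℝ (Fin l)) : ℂ) / 2) = 1 := by
    have : ((Real.pi / (1/2) : ℂ)) ^ ((Module.finrank ℝ (EuclideanSpace ℝ (Fin l)) : ℂ) / 2)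
      = (((2 * Real.pi) ^ ((l : ℝ) / 2) : ℝ) : ℂ) := by
      rw [Complex.ofReal_cpow (by positivity)]
      congr 1
      · push_cast; ring
      · simp
    rw [this, ← Complex.ofReal_mul, ← Real.rpow_add (by positivity)]
    simp [neg_div]
  rw [h3, one_mul]
  congr 1
  rw [Complex.I_sq]
  ring

set_option linter.unusedSectionVars false

section det
variable {E : Type*} [NormedAddCommGroup E] [InnerProductSpace ℝ E] [FiniteDimensional ℝ E]
  [MeasurableSpace E] [BorelSpace E]

/-- The projected radial normalisation. -/
noncomputable def radT (r s : ℝ) (y : E) : E := (r / Real.sqrt (‖y‖ ^ 2 + s ^ 2)) • y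

/-- Inverse of `radT`. -/
noncomputable def radS (r s : ℝ) (w : E) : E := (s / Real.sqrt (r ^ 2 - ‖w‖ ^ 2)) • w

lemma radS_radT {r s : ℝ} (hr : 0 < r) (hs : 0 < s) (y : E) : radS r s (radT r s y) = y := by
  unfold radS radT
  set q := Real.sqrt (‖y‖ ^ 2 + s ^ 2) with hq
  have hq0 : 0 < q := Real.sqrt_pos.2 (by positivity)
  have hq2 : q ^ 2 = ‖y‖ ^ 2 + s ^ 2 := Real.sq_sqrt (by positivity)
  have h1 : r ^ 2 - ‖(r / q) • y‖ ^ 2 = (r * s / q) ^ 2 := by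
    rw [norm_smul, Real.norm_of_nonneg (by positivity)]
    field_simp
    rw [hq2]; ring
  rw [h1, Real.sqrt_sq (by positivity), smul_smul]
  have : s / (r * s / q) * (r / q) = 1 := by field_simp
  rw [this, one_smul]

lemma norm_radT_le {r s : ℝ} (hr : 0 < r) (hs : 0 < s) (h : r ≤ 2 * s) (y : E) :
    ‖radT r s y‖ ≤ 2 * ‖y‖ := by
  unfold radT
  rw [norm_smul, Real.norm_of_nonneg (by positivity)]
  gcongr
  have : s ≤ Real.sqrt (‖y‖ ^ 2 + s ^ 2) := Real.le_sqrt_of_sq_le (by nlinarith [sq_nonneg ‖y‖])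
  rw [div_le_iff₀ (by linarith)]
  linarith

lemma radS_lip {r s M : ℝ} (hr : 0 < r) (hs : 0 < s) (hM : 0 < M) (h : s ≤ 2 * r)
    (hMr : 2 * M ≤ r) :
    LipschitzOnWith 8 (radS r s) (Metric.closedBall (0 : E) M) := by
  apply LipschitzOnWith.of_dist_le_mul
  intro w hw v hv
  rw [mem_closedBall_zero_iff] at hw hv
  rw [dist_eq_norm, dist_eq_norm]
  unfold radS
  have hap : ∀ u : E, ‖u‖ ≤ M → r / 2 ≤ Real.sqrt (r ^ 2 - ‖u‖ ^ 2) := by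
    intro u hu
    apply Real.le_sqrt_of_sq_le
    nlinarith [norm_nonneg u]
  have ha2 : ∀ u : E, ‖u‖ ≤ M → Real.sqrt (r ^ 2 - ‖u‖ ^ 2) ^ 2 = r ^ 2 - ‖u‖ ^ 2 := by
    intro u hu
    apply Real.sq_sqrt
    nlinarith [norm_nonneg u]
  have haw := hap w hw
  have hav := hap v hv
  have haw2 := ha2 w hw
  have hav2 := ha2 v hv
  set a := Real.sqrt (r ^ 2 - ‖w‖ ^ 2)
  set b := Real.sqrt (r ^ 2 - ‖v‖ ^ 2)
  have ha0 : 0 < a := by linarith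
  have hb0 : 0 < b := by linarith
  have hd : |‖w‖ - ‖v‖| ≤ ‖w - v‖ := abs_norm_sub_norm_le w v
  have hab : |b - a| ≤ ‖w - v‖ := by
    have e : (b - a) * (b + a) = (‖w‖ - ‖v‖) * (‖w‖ + ‖v‖) := by
      nlinarith
    have e2 : |b - a| * (b + a) ≤ ‖w - v‖ * (b + a) := by
      calc |b - a| * (b + a) = |(b - a) * (b + a)| := by
            rw [abs_mul, abs_of_pos (by positivity : 0 < b + a)]
        _ = |‖w‖ - ‖v‖| * (‖w‖ + ‖v‖) := by
            rw [e, abs_mul, abs_of_nonneg (by positivity : 0 ≤ ‖w‖ + ‖v‖)]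
        _ ≤ ‖w - v‖ * (b + a) := by
            gcongr <;> linarith
    exact le_of_mul_le_mul_right e2 (by positivity)
  have e3 : (s / a) • w - (s / b) • v = (s / a) • (w - v) + ((s / (a * b)) * (b - a)) • v := by
    have : (s / (a * b)) * (b - a) = s / a - s / b := by field_simp
    rw [this, smul_sub, sub_smul]
    abel
  have hsa : s / a ≤ 4 := by rw [div_le_iff₀ ha0]; linarith
  have hvb : ‖v‖ / b ≤ 1 := by rw [div_le_iff₀ hb0]; linarith
  rw [e3]
  calc _ ≤ ‖(s / a) • (w - v)‖ + ‖((s / (a * b)) * (b - a)) • v‖ := norm_add_le _ _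
    _ = (s / a) * ‖w - v‖ + (s / a) * |b - a| * (‖v‖ / b) := by
      rw [norm_smul, norm_smul, Real.norm_eq_abs, Real.norm_eq_abs, abs_mul,
        abs_of_pos (by positivity : 0 < s / a), abs_of_pos (by positivity : 0 < s / (a * b))]
      field_simp
    _ ≤ 4 * ‖w - v‖ + 4 * ‖w - v‖ * 1 := by gcongr
    _ = _ := by simp; ring

/-- Mass of large balls. -/
lemma exists_ball_compl (γ : Measure E) [IsProbabilityMeasure γ] {ε : ℝ} (hε : 0 < ε) :
    ∃ M : ℝ, 0 < M ∧ γ.real (Metric.closedBall (0 : E) M)ᶜ ≤ ε := by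
  have h : Tendsto (fun n : ℕ => γ.real (Metric.closedBall (0 : E) n)ᶜ) atTop (nhds 0) := by
    have := tendsto_measure_iInter_atTop (μ := γ)
      (s := fun n : ℕ => (Metric.closedBall (0 : E) n)ᶜ)
      (fun n => Metric.isClosed_closedBall.measurableSet.compl.nullMeasurableSet)
      (fun m n h => Set.compl_subset_compl.2 (Metric.closedBall_subset_closedBall (by simpa)))
      ⟨0, measure_ne_top _ _⟩
    have h0 : ⋂ n : ℕ, (Metric.closedBall (0 : E) n)ᶜ = ∅ := by
      rw [← Set.compl_iUnion, Metric.iUnion_closedBall_nat, Set.compl_univ]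
    rw [h0, measure_empty] at this
    exact (ENNReal.tendsto_toReal ENNReal.zero_ne_top).comp this
  obtain ⟨n, hn, hn0⟩ := ((h.eventually_le_const hε).and (eventually_gt_atTop 0)).exists
  exact ⟨n, by exact_mod_cast hn0, hn⟩

/-- uniform absolute continuity -/
lemma small_sets (γ H : Measure E) [IsProbabilityMeasure γ]
    (hH : H = Measure.hausdorffMeasure (Module.finrank ℝ E : ℝ)) (c : NNReal)
    (hγ : γ ≤ c • H)
    (r s : ℕ → ℝ) (hr : Tendsto r atTop atTop)
    (hsr : Tendsto (fun m => s m / r m) atTop (nhds 1)) {ε : ℝ} (hε : 0 < ε) :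
    ∃ δ : ℝ≥0∞, δ ≠ 0 ∧ ∀ B : Set E, H B ≤ δ → ∀ᶠ m in atTop, γ.real (radT (r m) (s m) ⁻¹' B) ≤ ε := by
  obtain ⟨M, hM0, hM⟩ := exists_ball_compl γ (half_pos hε)
  set C : NNReal := c * 8 ^ (Module.finrank ℝ E) + 1 with hC
  refine ⟨ENNReal.ofReal (ε / 2 / C), ?_, ?_⟩
  · have : 0 < ε / 2 / C := by positivity
    simpa using this
  intro B hB
  filter_upwards [hr.eventually_ge_atTop (4 * M), hr.eventually_gt_atTop 0,
    hsr.eventually_le_const (by norm_num : (1 : ℝ) < 2),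
    hsr.eventually_const_le (by norm_num : (1 / 2 : ℝ) < 1)] with m h1 h2 h3 h4
  rw [div_le_iff₀ h2] at h3
  rw [le_div_iff₀ h2] at h4
  have hs : 0 < s m := by linarith
  have hsub : radT (r m) (s m) ⁻¹' B ⊆ (Metric.closedBall (0 : E) M)ᶜ ∪
      radS (r m) (s m) '' (B ∩ Metric.closedBall 0 (2 * M)) := by
    intro y hy
    by_cases hyM : y ∈ Metric.closedBall (0 : E) M
    · right
      refine ⟨radT (r m) (s m) y, ⟨hy, ?_⟩, radS_radT h2 hs y⟩
      rw [mem_closedBall_zero_iff] at hyM ⊢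
      refine (norm_radT_le h2 hs (by linarith) y).trans (by linarith)
    · exact Or.inl hyM
  have hlip : H (radS (r m) (s m) '' (B ∩ Metric.closedBall 0 (2 * M))) ≤ 8 ^ (Module.finrank ℝ E) * H B := by
    have L := (radS_lip (E := E) h2 hs (by linarith : 0 < 2 * M) (by linarith) (by linarith)).mono
      (Set.inter_subset_right (s := B))
    have := L.hausdorffMeasure_image_le (d := (Module.finrank ℝ E : ℝ)) (by positivity)
    rw [← hH] at this
    refine this.trans ?_
    rw [ENNReal.rpow_natCast]
    gcongr
    · simp
    · exact Set.inter_subset_left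
  have hsm : γ.real (radS (r m) (s m) '' (B ∩ Metric.closedBall 0 (2 * M))) ≤ ε / 2 := by
    apply ENNReal.toReal_le_of_le_ofReal (by positivity)
    calc _ ≤ (c • H) (radS (r m) (s m) '' (B ∩ Metric.closedBall 0 (2 * M))) := hγ _
      _ ≤ c * (8 ^ (Module.finrank ℝ E) * H B) := by
        rw [Measure.smul_apply, ENNReal.smul_def, smul_eq_mul]
        gcongr
      _ ≤ C * ENNReal.ofReal (ε / 2 / C) := by
        rw [← mul_assoc]
        gcongr
        rw [hC]
        push_cast
        exact le_self_add
      _ = ENNReal.ofReal (ε / 2) := by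
        rw [← ENNReal.ofReal_coe_nnreal, ← ENNReal.ofReal_mul (by positivity)]
        congr 1
        have : (C : ℝ) ≠ 0 := by positivity
        field_simp
  calc _ ≤ γ.real ((Metric.closedBall (0 : E) M)ᶜ ∪
      radS (r m) (s m) '' (B ∩ Metric.closedBall 0 (2 * M))) := measureReal_mono hsub
    _ ≤ _ := measureReal_union_le _ _
    _ ≤ ε := by linarith

lemma radT_tendsto (r s : ℕ → ℝ) (hr : Tendsto r atTop atTop)
    (hsr : Tendsto (fun m => s m / r m) atTop (nhds 1)) (y : E) :
    Tendsto (fun m => radT (r m) (s m) y) atTop (nhds y) := by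
  have h : Tendsto (fun m => (Real.sqrt ((‖y‖ / r m) ^ 2 + (s m / r m) ^ 2))⁻¹) atTop
      (nhds (Real.sqrt (0 ^ 2 + 1 ^ 2))⁻¹) := by
    have h1 : Tendsto (fun m => ‖y‖ / r m) atTop (nhds 0) := hr.const_div_atTop _
    exact (((h1.pow 2).add (hsr.pow 2)).sqrt).inv₀ (by simp)
  have h2 : Tendsto (fun m => r m / Real.sqrt (‖y‖ ^ 2 + (s m) ^ 2)) atTop (nhds 1) := by
    have e : (Real.sqrt (0 ^ 2 + 1 ^ 2))⁻¹ = 1 := by simp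
    rw [e] at h
    refine h.congr' ?_
    filter_upwards [hr.eventually_gt_atTop 0] with m hm
    rw [div_pow, div_pow, ← add_div, Real.sqrt_div (by positivity), Real.sqrt_sq hm.le, inv_div]
  simpa [radT] using h2.smul_const y

lemma open_lower (γ : Measure E) [IsProbabilityMeasure γ]
    (r s : ℕ → ℝ) (hr : Tendsto r atTop atTop)
    (hsr : Tendsto (fun m => s m / r m) atTop (nhds 1)) {ε : ℝ} (hε : 0 < ε)
    (U : Set E) (hU : IsOpen U) :
    ∀ᶠ m in atTop, γ.real U ≤ γ.real (radT (r m) (s m) ⁻¹' U) + ε := by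
  set V : ℕ → Set E := fun N => {y | ∀ m ≥ N, radT (r m) (s m) y ∈ U} with hV
  have hmono : Monotone V := fun a b hab y hy m hm => hy m (hab.trans hm)
  have hsub : U ⊆ ⋃ N, V N := by
    intro y hy
    have := (radT_tendsto r s hr hsr y).eventually (hU.mem_nhds hy)
    obtain ⟨N, hN⟩ := eventually_atTop.1 this
    exact Set.mem_iUnion.2 ⟨N, hN⟩
  have h1 : Tendsto (fun N => γ.real (V N)) atTop (nhds (γ.real (⋃ N, V N))) :=
    (ENNReal.tendsto_toReal (measure_ne_top _ _)).comp (tendsto_measure_iUnion_atTop hmono)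
  have h2 : γ.real U ≤ γ.real (⋃ N, V N) := measureReal_mono hsub
  filter_upwards [h1.eventually_const_lt (show γ.real (⋃ N, V N) - ε < _ by linarith)] with N hN
  have : γ.real (V N) ≤ γ.real (radT (r N) (s N) ⁻¹' U) :=
    measureReal_mono (fun y hy => hy N le_rfl)
  linarith

lemma meas_lower (γ H : Measure E) [IsProbabilityMeasure γ]
    (hH : H = Measure.hausdorffMeasure (Module.finrank ℝ E : ℝ)) (c : NNReal)
    (hγ : γ ≤ c • H)
    (r s : ℕ → ℝ) (hr : Tendsto r atTop atTop)
    (hsr : Tendsto (fun m => s m / r m) atTop (nhds 1)) {ε : ℝ} (hε : 0 < ε)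
    (A : Set E) (hA : MeasurableSet A) :
    ∀ᶠ m in atTop, γ.real A ≤ γ.real (radT (r m) (s m) ⁻¹' A) + ε := by
  have hHaar : H.IsAddHaarMeasure := by rw [hH]; infer_instance
  obtain ⟨M, hM0, hM⟩ := exists_ball_compl γ (ε := ε / 3) (by positivity)
  obtain ⟨δ, hδ, hsm⟩ := small_sets γ H hH c hγ r s hr hsr (ε := ε / 3) (by positivity)
  have hA'm : MeasurableSet (A ∩ Metric.closedBall (0 : E) M) :=
    hA.inter Metric.isClosed_closedBall.measurableSet
  have hfin : H (A ∩ Metric.closedBall (0 : E) M) ≠ ∞ :=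
    ((measure_mono Set.inter_subset_right).trans_lt
      (isCompact_closedBall (0 : E) M).measure_lt_top).ne
  obtain ⟨U, hAU, hUo, -, hU⟩ := hA'm.exists_isOpen_sdiff_lt hfin hδ
  filter_upwards [hsm _ hU.le, open_lower γ r s hr hsr (ε := ε / 3) (by positivity) U hUo]
    with m h1 h2
  have h3 : γ.real A ≤ γ.real (A ∩ Metric.closedBall (0 : E) M) +
      γ.real (Metric.closedBall (0 : E) M)ᶜ := by
    refine (measureReal_mono ?_).trans (measureReal_union_le _ _)
    intro y hy
    by_cases h : y ∈ Metric.closedBall (0 : E) M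
    · exact Or.inl ⟨hy, h⟩
    · exact Or.inr h
  have h4 : γ.real (A ∩ Metric.closedBall (0 : E) M) ≤ γ.real U := measureReal_mono hAU
  have h5 : γ.real (radT (r m) (s m) ⁻¹' U) ≤ γ.real (radT (r m) (s m) ⁻¹' A) +
      γ.real (radT (r m) (s m) ⁻¹' (U \ (A ∩ Metric.closedBall (0 : E) M))) := by
    refine (measureReal_mono ?_).trans (measureReal_union_le _ _)
    intro y hy
    by_cases h : radT (r m) (s m) y ∈ A ∩ Metric.closedBall (0 : E) M
    · exact Or.inl h.1
    · exact Or.inr ⟨hy, h⟩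
  linarith

lemma meas_tendsto (γ H : Measure E) [IsProbabilityMeasure γ]
    (hH : H = Measure.hausdorffMeasure (Module.finrank ℝ E : ℝ)) (c : NNReal)
    (hγ : γ ≤ c • H)
    (r s : ℕ → ℝ) (hr : Tendsto r atTop atTop)
    (hsr : Tendsto (fun m => s m / r m) atTop (nhds 1))
    (A : Set E) (hA : MeasurableSet A) :
    Tendsto (fun m => γ.real (radT (r m) (s m) ⁻¹' A)) atTop (nhds (γ.real A)) := by
  rw [Metric.tendsto_nhds]
  intro ε hε
  filter_upwards [meas_lower γ H hH c hγ r s hr hsr (half_pos hε) A hA,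
    meas_lower γ H hH c hγ r s hr hsr (half_pos hε) Aᶜ hA.compl] with m h1 h2
  have hT : Measurable (radT (E := E) (r m) (s m)) := by unfold radT; fun_prop
  rw [Set.preimage_compl, probReal_compl_eq_one_sub hA, probReal_compl_eq_one_sub (hT hA)] at h2
  rw [Real.dist_eq, abs_lt]
  constructor <;> linarith
end det

/-- Product of countably many standard Gaussians. -/
noncomputable def gaussSeq : Measure (ℕ → ℝ) := Measure.infinitePi (fun _ => gaussianReal 0 1)

instance : IsProbabilityMeasure gaussSeq := by unfold gaussSeq; infer_instance

/-- Concatenation. -/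
noncomputable def catVec (l m : ℕ) (p : EuclideanSpace ℝ (Fin l) × (ℕ → ℝ)) :
    EuclideanSpace ℝ (Fin (l + m)) :=
  WithLp.toLp 2 (Fin.append (fun i => p.1 i) (fun j : Fin m => p.2 j))

lemma measurable_catVec (l m : ℕ) : Measurable (catVec l m) := by
  unfold catVec
  refine (WithLp.measurable_toLp 2 _).comp ?_
  rw [measurable_pi_iff]
  intro i
  refine Fin.addCases (fun i => ?_) (fun j => ?_) i
  · simp only [Fin.append_left]; fun_prop
  · simp only [Fin.append_right]; fun_prop

lemma gaussSeq_map (m : ℕ) :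
    gaussSeq.map (fun z => (WithLp.toLp 2 (fun j : Fin m => z j) : EuclideanSpace ℝ (Fin m)))
      = stdGaussian (EuclideanSpace ℝ (Fin m)) := by
  rw [← map_pi_eq_stdGaussian, ← Measure.infinitePi_eq_pi,
    ← Measure.map_infinitePi_infinitePi_of_inj (P := fun _ : ℕ => gaussianReal 0 1)
      (f := fun j : Fin m => (j : ℕ)) Fin.val_injective,
    Measure.map_map (by fun_prop) (by fun_prop)]
  rfl

lemma catVec_law (l m : ℕ) :
    ((stdGaussian (EuclideanSpace ℝ (Fin l))).prod gaussSeq).map (catVec l m)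
      = stdGaussian (EuclideanSpace ℝ (Fin (l + m))) := by
  have := Measure.isProbabilityMeasure_map
    (μ := (stdGaussian (EuclideanSpace ℝ (Fin l))).prod gaussSeq)
    (measurable_catVec l m).aemeasurable
  apply Measure.ext_of_charFun
  ext t
  set t1 : EuclideanSpace ℝ (Fin l) := WithLp.toLp 2 (fun i => t (Fin.castAdd m i)) with ht1
  set t2 : EuclideanSpace ℝ (Fin m) := WithLp.toLp 2 (fun i => t (Fin.natAdd l i)) with ht2
  rw [charFun_stdGaussian, charFun_apply, integral_map (measurable_catVec l m).aemeasurable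
    (by apply Continuous.aestronglyMeasurable; fun_prop)]
  have h1 : ∀ p : EuclideanSpace ℝ (Fin l) × (ℕ → ℝ),
      Complex.exp ((inner ℝ (catVec l m p) t : ℝ) * Complex.I) =
      Complex.exp ((inner ℝ p.1 t1 : ℝ) * Complex.I) *
      Complex.exp ((inner ℝ (WithLp.toLp 2 (fun j : Fin m => p.2 j)) t2 : ℝ) * Complex.I) := by
    intro p
    rw [← Complex.exp_add, ← add_mul, ← Complex.ofReal_add]
    congr 3
    simp [PiLp.inner_apply, catVec, Fin.sum_univ_add, ht1, ht2]
  simp_rw [h1]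
  rw [integral_prod_mul (fun y => Complex.exp ((inner ℝ y t1 : ℝ) * Complex.I))
    (fun z : ℕ → ℝ => Complex.exp ((inner ℝ (WithLp.toLp 2 (fun j : Fin m => z j)) t2 : ℝ)
      * Complex.I)), ← charFun_apply, charFun_stdGaussian]
  have h2 : ∫ z : ℕ → ℝ, Complex.exp ((inner ℝ (WithLp.toLp 2 (fun j : Fin m => z j)) t2 : ℝ)
      * Complex.I) ∂gaussSeq = charFun (stdGaussian (EuclideanSpace ℝ (Fin m))) t2 := by
    rw [← gaussSeq_map, charFun_apply, integral_map (Measurable.aemeasurable (by fun_prop))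
      (by apply Continuous.aestronglyMeasurable; fun_prop)]
  rw [h2, charFun_stdGaussian, ← Complex.exp_add]
  congr 1
  have h3 : ‖t‖ ^ 2 = ‖t1‖ ^ 2 + ‖t2‖ ^ 2 := by
    simp [EuclideanSpace.real_norm_sq_eq, Fin.sum_univ_add, ht1, ht2]
  have h4 : (‖t‖ : ℂ) ^ 2 = (‖t1‖ : ℂ) ^ 2 + (‖t2‖ : ℂ) ^ 2 := by exact_mod_cast h3
  rw [h4]
  ring

lemma slln_sq : ∀ᵐ z ∂gaussSeq,
    Tendsto (fun m : ℕ => (∑ i ∈ Finset.range m, (z i) ^ 2) / (m : ℝ)) atTop (nhds 1) := by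
  have hm : ∀ i, gaussSeq.map (fun z : ℕ → ℝ => z i) = gaussianReal 0 1 := fun i =>
    Measure.infinitePi_map_eval _ i
  have hid : ∀ i, IdentDistrib (fun z : ℕ → ℝ => (z i)) (fun z => z 0) gaussSeq gaussSeq :=
    fun i => ⟨Measurable.aemeasurable (by fun_prop), Measurable.aemeasurable (by fun_prop), by rw [hm, hm]⟩
  have hsq : Integrable (fun x : ℝ => x ^ 2) (gaussianReal 0 1) :=
    (memLp_id_gaussianReal (μ := 0) (v := 1) 2).integrable_sq
  have hind : iIndepFun (fun i (z : ℕ → ℝ) => (z i) ^ 2) gaussSeq :=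
    iIndepFun_infinitePi (P := fun _ : ℕ => gaussianReal 0 1) (X := fun _ x => x ^ 2)
      (fun _ => by fun_prop)
  have h := strong_law_ae_real (μ := gaussSeq) (fun i z => (z i) ^ 2)
    (by
      rw [← hm 0] at hsq
      exact hsq.comp_measurable (by fun_prop))
    (fun i j hij => hind.indepFun hij)
    (fun i => (hid i).comp (u := fun x => x ^ 2) (by fun_prop))
  have he : ∫ z, (z 0) ^ 2 ∂gaussSeq = 1 := by
    rw [← integral_map (μ := gaussSeq) (φ := fun z : ℕ → ℝ => z 0) (f := fun x => x ^ 2)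
      (Measurable.aemeasurable (by fun_prop)) (by fun_prop), hm 0]
    have := variance_id_gaussianReal (μ := 0) (v := 1)
    rw [variance_of_integral_eq_zero (by fun_prop) (by simp)] at this
    simpa using this
  rw [he] at h
  exact h

lemma stdGaussian_ne_zero {k : ℕ} (hk : 0 < k) :
    ∀ᵐ x ∂(stdGaussian (EuclideanSpace ℝ (Fin k))), x ≠ 0 := by
  have : Nonempty (Fin k) := ⟨⟨0, hk⟩⟩
  have h : stdGaussian (EuclideanSpace ℝ (Fin k)) ≪ volume := by
    rw [stdGaussian_density]; exact withDensity_absolutelyContinuous _ _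
  apply h.ae_le
  exact Measure.ae_ne volume 0

/-- Any invariant probability measure on the sphere is the normalised Gaussian. -/
lemma sphere_eq_gaussian {k : ℕ} (hk : 0 < k) {r : ℝ} (hr : 0 < r)
    (σ : Measure (EuclideanSpace ℝ (Fin k))) [IsProbabilityMeasure σ]
    (hσ : ∀ᵐ x ∂σ, ‖x‖ = r)
    (iσ : ∀ O : EuclideanSpace ℝ (Fin k) ≃ₗᵢ[ℝ] EuclideanSpace ℝ (Fin k), σ.map (⇑O) = σ) :
    σ = (stdGaussian (EuclideanSpace ℝ (Fin k))).map (fun x => (r / ‖x‖) • x) := by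
  have hN : Measurable (fun x : EuclideanSpace ℝ (Fin k) => (r / ‖x‖) • x) := by fun_prop
  have := Measure.isProbabilityMeasure_map
    (μ := stdGaussian (EuclideanSpace ℝ (Fin k))) hN.aemeasurable
  refine invariant_unique hr _ _ hσ ?_ iσ ?_
  · rw [ae_map_iff hN.aemeasurable (measurableSet_eq_fun (by fun_prop) (by fun_prop))]
    filter_upwards [stdGaussian_ne_zero hk] with x hx
    have : 0 < ‖x‖ := norm_pos_iff.2 hx
    rw [norm_smul, Real.norm_of_nonneg (by positivity)]
    field_simp
  · intro O
    have hO : Measurable O := O.continuous.measurable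
    conv_rhs => rw [← stdGaussian_map O]
    rw [Measure.map_map hO hN, Measure.map_map hN hO]
    congr 1
    ext1 x
    simp

lemma norm_catVec (l m : ℕ) (p : EuclideanSpace ℝ (Fin l) × (ℕ → ℝ)) :
    ‖catVec l m p‖ = Real.sqrt (‖p.1‖ ^ 2 + Real.sqrt (∑ i ∈ Finset.range m, (p.2 i) ^ 2) ^ 2) := by
  rw [Real.sq_sqrt (Finset.sum_nonneg fun i _ => sq_nonneg _), EuclideanSpace.norm_eq]
  congr 1
  rw [EuclideanSpace.real_norm_sq_eq, Finset.sum_range]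
  simp [Fin.sum_univ_add, catVec]

lemma proj_catVec (l m : ℕ) (r : ℝ) (p : EuclideanSpace ℝ (Fin l) × (ℕ → ℝ)) :
    projEuclid l m ((r / ‖catVec l m p‖) • catVec l m p) =
      radT r (Real.sqrt (∑ i ∈ Finset.range m, (p.2 i) ^ 2)) p.1 := by
  rw [norm_catVec]
  unfold radT projEuclid
  ext i
  have : Fin.castLE (Nat.le_add_right l m) i = Fin.castAdd m i := rfl
  simp [this, catVec]

lemma measurable_projEuclid (l m : ℕ) : Measurable (projEuclid l m) := by
  unfold projEuclid
  refine (WithLp.measurable_toLp 2 _).comp ?_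
  rw [measurable_pi_iff]
  intro i
  simp only [WithLp.equiv_apply]
  fun_prop

/-- The standard Gaussian is dominated by a multiple of Hausdorff measure. -/
lemma gaussian_le (l : ℕ) : ∃ c : NNReal, stdGaussian (EuclideanSpace ℝ (Fin l)) ≤
    c • (Measure.hausdorffMeasure (Module.finrank ℝ (EuclideanSpace ℝ (Fin l)) : ℝ) :
      Measure (EuclideanSpace ℝ (Fin l))) := by
  refine ⟨Measure.addHaarScalarFactor (volume : Measure (EuclideanSpace ℝ (Fin l))) (Measure.hausdorffMeasure
    (Module.finrank ℝ (EuclideanSpace ℝ (Fin l)) : ℝ)), ?_⟩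
  rw [← Measure.isAddLeftInvariant_eq_smul, stdGaussian_density]
  conv_rhs => rw [← withDensity_one (μ := (volume : Measure (EuclideanSpace ℝ (Fin l))))]
  apply withDensity_mono
  refine Eventually.of_forall fun y => ?_
  simp only [Pi.one_apply, ENNReal.ofReal_le_one]
  apply mul_le_one₀
  · apply Real.rpow_le_one_of_one_le_of_nonpos
    · nlinarith [Real.pi_gt_three]
    · have : (0 : ℝ) ≤ l := by positivity
      linarith
  · positivity
  · apply Real.exp_le_one_iff.2
    nlinarith [sq_nonneg ‖y‖]

/-- Poincaré's limit theorem: the projections onto the first l coordinates of the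
uniform measures on the spheres of radius √k in ℝ^k converge, as k → ∞, to the
standard Gaussian measure on ℝ^l.  The uniform measure is characterized as the
rotation-invariant probability measure carried by the sphere. -/
theorem poincare_limit (l : ℕ) (hl : 1 ≤ l)
    (σ : ∀ k : ℕ, Measure (EuclideanSpace ℝ (Fin k)))
    (hprob : ∀ k, IsProbabilityMeasure (σ k))
    (hsphere : ∀ k, σ k (Metric.sphere (0 : EuclideanSpace ℝ (Fin k)) (Real.sqrt (k : ℝ))) = 1)
    (hinv : ∀ (k : ℕ) (O : EuclideanSpace ℝ (Fin k) ≃ₗᵢ[ℝ] EuclideanSpace ℝ (Fin k)),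
      Measure.map (⇑O) (σ k) = σ k)
    (A : Set (EuclideanSpace ℝ (Fin l))) (hA : MeasurableSet A) :
    Tendsto
      (fun m : ℕ =>
        (σ (l + m) (projEuclid l m ⁻¹' A ∩
          Metric.sphere (0 : EuclideanSpace ℝ (Fin (l + m))) (Real.sqrt ((l + m : ℕ) : ℝ)))).toReal)
      atTop
      (nhds ((2 * Real.pi) ^ (-(l : ℝ) / 2) * ∫ y in A, Real.exp (-‖y‖ ^ 2 / 2))) := by
  set γ := stdGaussian (EuclideanSpace ℝ (Fin l)) with hγ
  have hlim : (2 * Real.pi) ^ (-(l : ℝ) / 2) * ∫ y in A, Real.exp (-‖y‖ ^ 2 / 2)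
      = γ.real A := by
    rw [hγ, stdGaussian_density, measureReal_def, withDensity_apply _ hA,
      ← integral_eq_lintegral_of_nonneg_ae (Eventually.of_forall fun y => by positivity)
        (Measurable.aestronglyMeasurable (by fun_prop)), integral_const_mul]
  set r : ℕ → ℝ := fun m => Real.sqrt ((l + m : ℕ) : ℝ) with hr
  set s : ℕ → (ℕ → ℝ) → ℝ := fun m z => Real.sqrt (∑ i ∈ Finset.range m, (z i) ^ 2) with hs
  have hr0 : ∀ m, 0 < r m := fun m => Real.sqrt_pos.2 (by exact_mod_cast (by omega))
  have hmeas : ∀ m, MeasurableSet {p : EuclideanSpace ℝ (Fin l) × (ℕ → ℝ) |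
      radT (r m) (s m p.2) p.1 ∈ A} := by
    intro m
    have : Measurable (fun p : EuclideanSpace ℝ (Fin l) × (ℕ → ℝ) =>
      radT (r m) (s m p.2) p.1) := by
      simp only [radT, hs]
      fun_prop
    exact this hA
  have hmain : ∀ m, (σ (l + m) (projEuclid l m ⁻¹' A ∩
      Metric.sphere (0 : EuclideanSpace ℝ (Fin (l + m))) (Real.sqrt ((l + m : ℕ) : ℝ)))).toReal
      = ∫ z, γ.real (radT (r m) (s m z) ⁻¹' A) ∂gaussSeq := by
    intro m
    have := hprob (l + m)
    have hs1 : ∀ᵐ x ∂(σ (l + m)), x ∈ Metric.sphere (0 : EuclideanSpace ℝ (Fin (l + m))) (r m) :=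
      (prob_compl_eq_zero_iff Metric.isClosed_sphere.measurableSet).2 (hsphere (l + m))
    have hs2 : ∀ᵐ x ∂(σ (l + m)), ‖x‖ = r m := by
      filter_upwards [hs1] with x hx using by simpa using hx
    have e1 : σ (l + m) (projEuclid l m ⁻¹' A ∩ Metric.sphere 0 (r m)) =
        σ (l + m) (projEuclid l m ⁻¹' A) :=
      measure_congr (by
        filter_upwards [hs1] with x hx
        exact propext ⟨fun h => h.1, fun h => ⟨h, hx⟩⟩)
    have hN : Measurable (fun x : EuclideanSpace ℝ (Fin (l + m)) => (r m / ‖x‖) • x) := by fun_prop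
    have hB := measurable_projEuclid l m hA
    change (σ (l + m) (projEuclid l m ⁻¹' A ∩ Metric.sphere 0 (r m))).toReal = _
    rw [e1, sphere_eq_gaussian (by omega) (hr0 m) (σ (l + m)) hs2 (hinv (l + m)),
      Measure.map_apply hN hB, ← catVec_law, Measure.map_apply (measurable_catVec l m) (hN hB)]
    have e2 : catVec l m ⁻¹' ((fun x => (r m / ‖x‖) • x) ⁻¹' (projEuclid l m ⁻¹' A)) =
        {p | radT (r m) (s m p.2) p.1 ∈ A} := by
      ext p
      simp only [Set.mem_preimage, Set.mem_ofPred_eq, proj_catVec, hs]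
    rw [e2, Measure.prod_apply_symm (hmeas m)]
    exact (integral_toReal (measurable_measure_prodMk_right (hmeas m)).aemeasurable
      (Eventually.of_forall fun z => measure_lt_top _ _)).symm
  simp_rw [hmain, hlim]
  have hc : γ.real A = ∫ _z, γ.real A ∂gaussSeq := by simp
  rw [hc]
  obtain ⟨c, hcH⟩ := gaussian_le l
  have hrt : Tendsto r atTop atTop := by
    refine Real.tendsto_sqrt_atTop.comp (tendsto_natCast_atTop_atTop.comp ?_)
    exact tendsto_atTop_mono (fun m => Nat.le_add_left m l) tendsto_id
  refine tendsto_integral_of_dominated_convergence (fun _ => 1) ?_ (integrable_const _) ?_ ?_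
  · intro m
    exact (measurable_measure_prodMk_right (hmeas m)).ennreal_toReal.aestronglyMeasurable
  · intro m
    refine Eventually.of_forall fun z => ?_
    rw [Real.norm_of_nonneg measureReal_nonneg]
    exact measureReal_le_one
  · filter_upwards [slln_sq] with z hz
    refine meas_tendsto γ _ rfl c hcH r (fun m => s m z) hrt ?_ A hA
    have h1 : Tendsto (fun m : ℕ => (m : ℝ) / ((l + m : ℕ) : ℝ)) atTop (nhds 1) := by
      have := tendsto_natCast_div_add_atTop (𝕜 := ℝ) (l : ℝ)
      refine this.congr fun m => ?_
      push_cast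
      rw [add_comm]
    have h2 := (hz.mul h1).sqrt
    rw [one_mul, Real.sqrt_one] at h2
    refine h2.congr' ?_
    filter_upwards [eventually_gt_atTop 0] with m hm
    have : (m : ℝ) ≠ 0 := by positivity
    rw [div_mul_div_cancel₀ this, Real.sqrt_div (Finset.sum_nonneg fun i _ => sq_nonneg _)]
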